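/- arXiv:2305.19104 — 3 statements merged into one kernel-verified Lean document; each statement's English description precedes it below -/
import Mathlib

section
/- Let G be a DAG with a unique sink. Then: (1) Pers(mold(G)) ≤ Pers(G) + 2; and (2) every unconditional reversible pebbling (P′₀,…,P′_τ) of mold(G) whose final configuration contains the sink of mold(G) has some configuration P′_b with |P′_b| ≥ Visit(G) + 2 and s ∈ P′_b. -/
/-! ## Directed graphs and pebbling -/

structure Dgraph where
  V : Type
  [fintypeV : Fintype V]
  [decEqV : DecidableEq V]
  edge : V → V → Prop

attribute [instance] Dgraph.fintypeV Dgraph.decEqV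

namespace Dgraph

/-- A directed graph is acyclic if no vertex lies on a directed cycle. -/
def Acyclic (G : Dgraph) : Prop :=
  ∀ v : G.V, ¬ Relation.TransGen G.edge v v

def IsSink (G : Dgraph) (z : G.V) : Prop := ∀ u : G.V, ¬ G.edge z u

def IsSource (G : Dgraph) (v : G.V) : Prop := ∀ u : G.V, ¬ G.edge u v

def UniqueSink (G : Dgraph) (z : G.V) : Prop :=
  G.IsSink z ∧ ∀ w : G.V, G.IsSink w → w = z

/-- Every vertex has in-degree at most 2. -/
def InDegLe2 (G : Dgraph) : Prop :=
  ∀ v : G.V, {u : G.V | G.edge u v}.ncard ≤ 2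

/-- One step of the reversible pebble game. -/
def RevStep (G : Dgraph) (P P' : Finset G.V) : Prop :=
  (∃ v : G.V, v ∉ P ∧ (∀ u : G.V, G.edge u v → u ∈ P) ∧ P' = insert v P) ∨
  (∃ v : G.V, v ∈ P ∧ (∀ u : G.V, G.edge u v → u ∈ P) ∧ P' = P.erase v)

/-- One step of the standard pebble game. -/
def StdStep (G : Dgraph) (P P' : Finset G.V) : Prop :=
  (∃ v : G.V, v ∉ P ∧ (∀ u : G.V, G.edge u v → u ∈ P) ∧ P' = insert v P) ∨
  (∃ v : G.V, v ∈ P ∧ P' = P.erase v)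

/-- An unconditional reversible pebbling of time `τ`. -/
def IsRevPebbling (G : Dgraph) (P : ℕ → Finset G.V) (τ : ℕ) : Prop :=
  P 0 = ∅ ∧ ∀ t < τ, G.RevStep (P t) (P (t+1))

/-- An unconditional standard pebbling of time `τ`. -/
def IsStdPebbling (G : Dgraph) (P : ℕ → Finset G.V) (τ : ℕ) : Prop :=
  P 0 = ∅ ∧ ∀ t < τ, G.StdStep (P t) (P (t+1))

/-- The space of a pebbling. -/
def space (G : Dgraph) (P : ℕ → Finset G.V) (τ : ℕ) : ℕ :=
  (Finset.range (τ+1)).sup fun t => (P t).card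

/-- Persistent (reversible) pebbling price of a vertex. -/
noncomputable def pers (G : Dgraph) (v : G.V) : ℕ :=
  sInf { s : ℕ | ∃ P τ, G.IsRevPebbling P τ ∧ P τ = {v} ∧ G.space P τ = s }

/-- Visiting (reversible) pebbling price of a vertex. -/
noncomputable def visit (G : Dgraph) (v : G.V) : ℕ :=
  sInf { s : ℕ | ∃ P τ, G.IsRevPebbling P τ ∧ v ∈ P τ ∧ G.space P τ = s }

/-- Surrounding (reversible) pebbling price of a vertex. -/
noncomputable def surround (G : Dgraph) (v : G.V) : ℕ :=
  sInf { s : ℕ | ∃ P τ, G.IsRevPebbling P τ ∧ (∀ u : G.V, G.edge u v → u ∈ P τ) ∧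
    G.space P τ = s }

/-- Standard pebbling price of a vertex. -/
noncomputable def black (G : Dgraph) (z : G.V) : ℕ :=
  sInf { s : ℕ | ∃ P τ, G.IsStdPebbling P τ ∧ P τ = {z} ∧ G.space P τ = s }

/-- Space of a pebbling counted only inside the region `R`. -/
noncomputable def spaceIn (G : Dgraph) (R : Set G.V) (P : ℕ → Finset G.V) (τ : ℕ) : ℕ :=
  (Finset.range (τ+1)).sup fun t => ((P t : Set G.V) ∩ R).ncard

/-- `R`-restricted persistent price. -/
noncomputable def persIn (G : Dgraph) (R : Set G.V) (v : G.V) : ℕ :=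
  sInf { s : ℕ | ∃ P τ, G.IsRevPebbling P τ ∧ ((P τ : Set G.V) ∩ R) = {v} ∧
    G.spaceIn R P τ = s }

/-- `R`-restricted visiting price. -/
noncomputable def visitIn (G : Dgraph) (R : Set G.V) (v : G.V) : ℕ :=
  sInf { s : ℕ | ∃ P τ, G.IsRevPebbling P τ ∧ v ∈ P τ ∧ G.spaceIn R P τ = s }

/-- `R`-restricted surrounding price. -/
noncomputable def surroundIn (G : Dgraph) (R : Set G.V) (v : G.V) : ℕ :=
  sInf { s : ℕ | ∃ P τ, G.IsRevPebbling P τ ∧ (∀ u : G.V, G.edge u v → u ∈ P τ) ∧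
    G.spaceIn R P τ = s }

/-- `B` blocks the graph: every directed path from a source to a sink meets `B`. -/
def Blocks (G : Dgraph) (B : Set G.V) : Prop :=
  ∀ (p : List G.V) (hp : p ≠ []), List.Chain' G.edge p →
    G.IsSource (p.head hp) → G.IsSink (p.getLast hp) → ∃ v ∈ p, v ∈ B

/-- A minimal blocking set. -/
def MinBlocking (G : Dgraph) (B : Set G.V) : Prop :=
  G.Blocks B ∧ ∀ B' : Set G.V, B' ⊂ B → ¬ G.Blocks B'

end Dgraph

/-! ## Concrete graph families -/

/-- The function `g` with `g 1 = 0` and `g Δ = 2^(g (Δ-1) + Δ - 2) + g (Δ-1)` for `Δ ≥ 2`. -/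
def g : ℕ → ℕ
  | 0 => 0
  | 1 => 0
  | (n+2) => 2 ^ (g (n+1) + n) + g (n+1)

/-- `ginv h = min {Δ ≥ 1 | g Δ ≥ h}`. -/
noncomputable def ginv (h : ℕ) : ℕ := sInf { Δ : ℕ | 1 ≤ Δ ∧ h ≤ g Δ }

/-- The pyramid of height `h`: vertices `(i,j)` with `i ≤ j ≤ h`, vertex `(i,j)` is
at level `i`, with edges `(i,j) → (i+1,j)` and `(i,j) → (i+1,j+1)` (when the target
is a vertex). -/
def pyramid (h : ℕ) : Dgraph where
  V := {p : Fin (h+1) × Fin (h+1) // (p.1 : ℕ) ≤ (p.2 : ℕ)}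
  edge u v := (v.1.1 : ℕ) = (u.1.1 : ℕ) + 1 ∧
    ((v.1.2 : ℕ) = (u.1.2 : ℕ) ∨ (v.1.2 : ℕ) = (u.1.2 : ℕ) + 1)

/-- The sink `(h,h)` of the pyramid of height `h`. -/
def pyramidSink (h : ℕ) : (pyramid h).V := ⟨(Fin.last h, Fin.last h), le_refl _⟩

/-- The complete binary tree of height `h`, with edges directed towards the root:
the vertex `⟨k, j⟩` is the `j`-th node at depth `k`, and its parent is `⟨k-1, j/2⟩`. -/
def bintree (h : ℕ) : Dgraph where
  V := Σ k : Fin (h+1), Fin (2 ^ (k : ℕ))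
  edge u v := (u.1 : ℕ) = (v.1 : ℕ) + 1 ∧ (u.2 : ℕ) / 2 = (v.2 : ℕ)

/-- The root (unique sink) of the complete binary tree. -/
def bintreeRoot (h : ℕ) : (bintree h).V := ⟨0, ⟨0, by positivity⟩⟩

/-- The chain of width `w` and length `ℓ`: layers `0,…,ℓ` of `w` vertices each, where the
`j`-th vertex of layer `i ≥ 1` has incoming edges from the `j`-th and `(j+1 mod w)`-th
vertices of layer `i-1`. -/
def chainDag (w ℓ : ℕ) : Dgraph where
  V := Fin (ℓ+1) × Fin w
  edge u v := (v.1 : ℕ) = (u.1 : ℕ) + 1 ∧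
    ((u.2 : ℕ) = (v.2 : ℕ) ∨ (u.2 : ℕ) = ((v.2 : ℕ) + 1) % w)

/-- The road of width `w` and length `ℓ`: a chain of width `w` and length `ℓ-w+1`
(layers `0,…,ℓ-w+1`) followed by a pyramid of height `w-1` whose sources are the vertices
of layer `ℓ-w+1`; layer `i` consists of the vertices `(i,j)` with `i + j ≤ ℓ`, `j < w`. -/
def road (w ℓ : ℕ) : Dgraph where
  V := {p : Fin (ℓ+1) × Fin w // (p.1 : ℕ) + (p.2 : ℕ) ≤ ℓ}
  edge u v := (v.1.1 : ℕ) = (u.1.1 : ℕ) + 1 ∧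
    ((u.1.2 : ℕ) = (v.1.2 : ℕ) ∨ (u.1.2 : ℕ) = ((v.1.2 : ℕ) + 1) % w)

/-- The sink of the road: the single vertex on the last layer. -/
def roadSink (w ℓ : ℕ) (hw : 0 < w) : (road w ℓ).V :=
  ⟨(Fin.last ℓ, ⟨0, hw⟩), by simp⟩

/-- The directed path of length `h`: vertices `0,…,h` and edges `i → i+1`. -/
def pathDag (h : ℕ) : Dgraph where
  V := Fin (h+1)
  edge u v := (v : ℕ) = (u : ℕ) + 1

/-- The sink of the directed path. -/
def pathSink (h : ℕ) : (pathDag h).V := Fin.last h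

/-- The `(h,ℓ)`-teabag: the pyramid of height `h` with a directed path of length `ℓ`
appended to its sink.  Layer `t ≤ h` consists of the pyramid vertices `(t,j)`, `t ≤ j ≤ h`,
and layer `t > h` consists of the single path vertex `(t,h)`. -/
def teabag (h ℓ : ℕ) : Dgraph where
  V := {p : Fin (h+ℓ+1) × Fin (h+1) //
          ((p.1 : ℕ) ≤ h → (p.1 : ℕ) ≤ (p.2 : ℕ)) ∧ (h ≤ (p.1 : ℕ) → (p.2 : ℕ) = h)}
  edge u v := (v.1.1 : ℕ) = (u.1.1 : ℕ) + 1 ∧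
    ((v.1.2 : ℕ) = (u.1.2 : ℕ) ∨ (v.1.2 : ℕ) = (u.1.2 : ℕ) + 1)

/-- The sink of the `(h,ℓ)`-teabag: the final path vertex. -/
def teabagSink (h ℓ : ℕ) : (teabag h ℓ).V :=
  ⟨(Fin.last (h+ℓ), Fin.last h), by refine ⟨fun hh => ?_, fun _ => ?_⟩ <;> simp_all⟩

/-- The molding `mold G` of a graph `G`: vertices `s` (= `none`), `v^in` (= `some (v,false)`)
and `v^out` (= `some (v,true)`) for `v ∈ V(G)`, with edges `v^in → v^out`,
`u^out → v^in` for every edge `(u,v)` of `G`, and `s → v^out` for every `v`. -/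
def mold (G : Dgraph) : Dgraph where
  V := Option (G.V × Bool)
  edge u v :=
    match u, v with
    | none, some (_, true) => True
    | some (a, false), some (b, true) => a = b
    | some (a, true), some (b, false) => G.edge a b
    | _, _ => False

/-- The special source `s` of `mold G`. -/
def moldSrc (G : Dgraph) : (mold G).V := none

/-- The vertex `v^out` of `mold G`. -/
def moldOut (G : Dgraph) (v : G.V) : (mold G).V := some (v, true)

/-! ## Helper material for the proof -/

/-- `X` can be reached from the empty configuration in space at most `k`. -/
def ReachK (G : Dgraph) (k : ℕ) (X : Finset G.V) : Prop :=
  ∃ P τ, G.IsRevPebbling P τ ∧ P τ = X ∧ ∀ t ≤ τ, (P t).card ≤ k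

theorem reachK_empty (G : Dgraph) (k : ℕ) : ReachK G k ∅ :=
  ⟨fun _ => ∅, 0, ⟨rfl, by simp⟩, rfl, by simp⟩

theorem reachK_step {G : Dgraph} {k : ℕ} {X Y : Finset G.V} (h : ReachK G k X)
    (hs : G.RevStep X Y) (hY : Y.card ≤ k) : ReachK G k Y := by
  obtain ⟨P, τ, ⟨h0, h1⟩, rfl, h3⟩ := h
  refine ⟨fun t => if t ≤ τ then P t else Y, τ + 1, ⟨by simp [h0], ?_⟩, by simp, ?_⟩
  · intro t ht
    rcases Nat.lt_or_ge t τ with h | h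
    · have h' : t + 1 ≤ τ := h
      simpa [h.le, h'] using h1 t h
    · have : t = τ := by omega
      subst this
      simpa using hs
  · intro t _
    by_cases h : t ≤ τ
    · simpa [h] using h3 t h
    · simpa [h] using hY

theorem ReachK.card_le {G : Dgraph} {k : ℕ} {X : Finset G.V} (h : ReachK G k X) :
    X.card ≤ k := by
  obtain ⟨P, τ, _, rfl, h3⟩ := h
  exact h3 τ le_rfl

theorem reachK_place {G : Dgraph} {k : ℕ} {X : Finset G.V} (h : ReachK G k X) (v : G.V)
    (hp : ∀ u, G.edge u v → u ∈ X) (hc : (insert v X).card ≤ k) : ReachK G k (insert v X) := by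
  by_cases hv : v ∈ X
  · rwa [Finset.insert_eq_of_mem hv]
  · exact reachK_step h (Or.inl ⟨v, hv, hp, rfl⟩) hc

theorem reachK_remove {G : Dgraph} {k : ℕ} {X : Finset G.V} (h : ReachK G k X) (v : G.V)
    (hp : ∀ u, G.edge u v → u ∈ X) : ReachK G k (X.erase v) := by
  by_cases hv : v ∈ X
  · exact reachK_step h (Or.inr ⟨v, hv, hp, rfl⟩) ((Finset.card_erase_le).trans h.card_le)
  · rwa [Finset.erase_eq_of_notMem hv]

theorem pers_le_of_reachK {G : Dgraph} {k : ℕ} {v : G.V} (h : ReachK G k {v}) :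
    G.pers v ≤ k := by
  obtain ⟨P, τ, h1, h2, h3⟩ := h
  refine le_trans (Nat.sInf_le ⟨P, τ, h1, h2, rfl⟩) ?_
  exact Finset.sup_le fun t ht => h3 t (by simpa [Nat.lt_succ_iff] using ht)

theorem visit_le_of_reachK {G : Dgraph} {k : ℕ} {v : G.V} {X : Finset G.V}
    (h : ReachK G k X) (hv : v ∈ X) : G.visit v ≤ k := by
  obtain ⟨P, τ, h1, h2, h3⟩ := h
  refine le_trans (Nat.sInf_le ⟨P, τ, h1, h2 ▸ hv, rfl⟩) ?_
  exact Finset.sup_le fun t ht => h3 t (by simpa [Nat.lt_succ_iff] using ht)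

theorem acyclic_exists_min {G : Dgraph} (hG : G.Acyclic) (X : Finset G.V)
    (hX : X ≠ Finset.univ) : ∃ v, v ∉ X ∧ ∀ u, G.edge u v → u ∈ X := by
  have hirr : Std.Irrefl (Relation.TransGen G.edge) := ⟨hG⟩
  have wf : WellFounded (Relation.TransGen G.edge) :=
    Finite.wellFounded_of_trans_of_irrefl _
  have hne : ({v | v ∉ X} : Set G.V).Nonempty := by
    by_contra hcon
    apply hX
    ext v
    by_contra hv
    exact hcon ⟨v, by simpa using hv⟩
  refine ⟨wf.min _ hne, wf.min_mem _ hne, fun u hu => ?_⟩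
  by_contra hcon
  exact wf.not_lt_min {v | v ∉ X} hcon (Relation.TransGen.single hu)

theorem reachK_all {G : Dgraph} (hG : G.Acyclic) (Y : Finset G.V) :
    ReachK G (Fintype.card G.V) Y := by
  have up : ∀ n : ℕ, ∀ X : Finset G.V, (Finset.univ \ X).card = n →
      ReachK G (Fintype.card G.V) X → ReachK G (Fintype.card G.V) Finset.univ := by
    intro n
    induction n using Nat.strong_induction_on with
    | _ n ih =>
      intro X hn hX
      by_cases hu : X = Finset.univ
      · rwa [← hu]
      · obtain ⟨v, hv, hp⟩ := acyclic_exists_min hG X hu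
        refine ih _ ?_ (insert v X) rfl (reachK_place hX v hp (Finset.card_le_univ _))
        rw [← hn]
        apply Finset.card_lt_card
        rw [Finset.ssubset_iff_of_subset (by intro a; grind)]
        exact ⟨v, by simpa using hv, by simp⟩
  have hfull := up _ ∅ rfl (reachK_empty G _)
  have down : ∀ n : ℕ, ∀ X : Finset G.V, (Finset.univ \ X).card = n →
      ReachK G (Fintype.card G.V) X := by
    intro n
    induction n using Nat.strong_induction_on with
    | _ n ih =>
      intro X hn
      by_cases hu : X = Finset.univ
      · rwa [hu]
      · obtain ⟨v, hv, hp⟩ := acyclic_exists_min hG X hu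
        have h := ih (Finset.univ \ insert v X).card ?_ (insert v X) rfl
        · have := reachK_remove h v (fun u hu => Finset.mem_insert_of_mem (hp u hu))
          rwa [Finset.erase_insert hv] at this
        · rw [← hn]
          apply Finset.card_lt_card
          rw [Finset.ssubset_iff_of_subset (by intro a; grind)]
          exact ⟨v, by simpa using hv, by simp⟩
  exact down _ Y rfl

/-- The vertex `v^in` of `mold G`. -/
def moldIn (G : Dgraph) (v : G.V) : (mold G).V := some (v, false)

theorem mold_edge_src (G : Dgraph) (u : (mold G).V) : ¬ (mold G).edge u (moldSrc G) := by
  rcases u with _ | ⟨a, _ | _⟩ <;> exact id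

theorem mold_edge_out (G : Dgraph) (u : (mold G).V) (v : G.V) :
    (mold G).edge u (moldOut G v) ↔ u = moldSrc G ∨ u = moldIn G v := by
  rcases u with _ | ⟨a, _ | _⟩ <;> simp [mold, moldOut, moldIn, moldSrc]

theorem mold_edge_in (G : Dgraph) (u : (mold G).V) (v : G.V) :
    (mold G).edge u (moldIn G v) ↔ ∃ w, u = moldOut G w ∧ G.edge w v := by
  rcases u with _ | ⟨a, _ | _⟩ <;> simp [mold, moldOut, moldIn]

theorem moldOut_inj (G : Dgraph) {v w : G.V} : moldOut G v = moldOut G w ↔ v = w := by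
  simp [moldOut, mold]

theorem moldIn_inj (G : Dgraph) {v w : G.V} : moldIn G v = moldIn G w ↔ v = w := by
  simp [moldIn, mold]

theorem moldOut_ne_in (G : Dgraph) {v w : G.V} : moldOut G v ≠ moldIn G w := by
  simp [moldIn, moldOut, mold]

theorem moldOut_ne_src (G : Dgraph) {v : G.V} : moldOut G v ≠ moldSrc G := by
  simp [moldSrc, moldOut, mold]

theorem moldIn_ne_out (G : Dgraph) {v w : G.V} : moldIn G v ≠ moldOut G w :=
  (moldOut_ne_in G).symm

theorem moldSrc_ne_out (G : Dgraph) {v : G.V} : moldSrc G ≠ moldOut G v :=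
  (moldOut_ne_src G).symm

theorem moldIn_ne_src (G : Dgraph) {v : G.V} : moldIn G v ≠ moldSrc G := by
  simp [moldSrc, moldIn, mold]

theorem mold_cases (G : Dgraph) (u : (mold G).V) :
    u = moldSrc G ∨ (∃ v, u = moldIn G v) ∨ ∃ v, u = moldOut G v := by
  rcases u with _ | ⟨a, _ | _⟩
  · exact Or.inl rfl
  · exact Or.inr (Or.inl ⟨a, rfl⟩)
  · exact Or.inr (Or.inr ⟨a, rfl⟩)

/-- The lift of a configuration of `G` to `mold G`. -/
def lift (G : Dgraph) (X : Finset G.V) : Finset (mold G).V :=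
  insert (moldSrc G) (X.image (moldOut G))

theorem mem_lift (G : Dgraph) (X : Finset G.V) (u : (mold G).V) :
    u ∈ lift G X ↔ u = moldSrc G ∨ ∃ v ∈ X, moldOut G v = u := by
  simp [lift]

theorem out_mem_lift (G : Dgraph) (X : Finset G.V) (v : G.V) :
    moldOut G v ∈ lift G X ↔ v ∈ X := by
  simp [mem_lift, moldOut_ne_src, moldOut_inj]

theorem card_lift_le (G : Dgraph) (X : Finset G.V) : (lift G X).card ≤ X.card + 1 :=
  (Finset.card_insert_le _ _).trans (Nat.succ_le_succ Finset.card_image_le)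

/-- The lift of a place move. -/
theorem lift_step {G : Dgraph} {k : ℕ} {X Y : Finset G.V} (hirr : ∀ v, ¬ G.edge v v)
    (h : G.RevStep X Y) (hX : X.card ≤ k) (hY : Y.card ≤ k)
    (hr : ReachK (mold G) (k + 2) (lift G X)) : ReachK (mold G) (k + 2) (lift G Y) := by
  have c1 := card_lift_le G X
  have c2 := card_lift_le G Y
  have hin : ∀ (Z : Finset G.V) v, moldIn G v ∉ lift G Z := by
    intro Z v
    simp [mem_lift, moldIn_ne_src, moldOut_ne_in]
  rcases h with ⟨v, hv, hp, rfl⟩ | ⟨v, hv, hp, rfl⟩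
  · have e : insert (moldOut G v) (lift G X) = lift G (insert v X) := by
      ext u; simp [mem_lift, eq_comm]; tauto
    have r1 := reachK_place hr (moldIn G v) (by
      intro u hu
      obtain ⟨w, rfl, hw⟩ := (mold_edge_in G u v).1 hu
      exact (out_mem_lift G X w).2 (hp w hw)) (by
        have := Finset.card_insert_le (moldIn G v) (lift G X); omega)
    have r2 := reachK_place r1 (moldOut G v) (by
      intro u hu
      rcases (mold_edge_out G u v).1 hu with rfl | rfl
      · simp [mem_lift]
      · simp) (by
        rw [Finset.insert_comm, e]
        have := Finset.card_insert_le (moldIn G v) (lift G (insert v X)); omega)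
    rw [Finset.insert_comm, e] at r2
    have r3 := reachK_remove r2 (moldIn G v) (by
      intro u hu
      obtain ⟨w, rfl, hw⟩ := (mold_edge_in G u v).1 hu
      exact Finset.mem_insert_of_mem
        ((out_mem_lift G _ w).2 (Finset.mem_insert_of_mem (hp w hw))))
    rwa [Finset.erase_insert (hin _ _)] at r3
  · have e : (insert (moldIn G v) (lift G X)).erase (moldOut G v)
        = insert (moldIn G v) (lift G (X.erase v)) := by
      ext u
      rcases mold_cases G u with rfl | ⟨w, rfl⟩ | ⟨w, rfl⟩
      · simp [mem_lift, moldSrc_ne_out]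
      · simp [mem_lift, moldOut_ne_in, moldIn_ne_out, moldIn_ne_src]
      · simp [out_mem_lift, moldOut_ne_in, moldOut_inj]
    have r1 := reachK_place hr (moldIn G v) (by
      intro u hu
      obtain ⟨w, rfl, hw⟩ := (mold_edge_in G u v).1 hu
      exact (out_mem_lift G X w).2 (hp w hw)) (by
        have := Finset.card_insert_le (moldIn G v) (lift G X); omega)
    have r2 := reachK_remove r1 (moldOut G v) (by
      intro u hu
      rcases (mold_edge_out G u v).1 hu with rfl | rfl
      · simp [mem_lift]
      · simp)
    rw [e] at r2
    have r3 := reachK_remove r2 (moldIn G v) (by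
      intro u hu
      obtain ⟨w, rfl, hw⟩ := (mold_edge_in G u v).1 hu
      refine Finset.mem_insert_of_mem
        ((out_mem_lift G _ w).2 (Finset.mem_erase.2 ⟨?_, hp w hw⟩))
      rintro rfl
      exact hirr _ hw)
    rwa [Finset.erase_insert (hin _ _)] at r3

theorem molding_upper (G : Dgraph) (hG : G.Acyclic) (z : G.V) :
    (mold G).pers (moldOut G z) ≤ G.pers z + 2 := by
  have hne : { s : ℕ | ∃ P τ, G.IsRevPebbling P τ ∧ P τ = {z} ∧ G.space P τ = s }.Nonempty := by
    obtain ⟨P, τ, h1, h2, _⟩ := reachK_all hG {z}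
    exact ⟨_, P, τ, h1, h2, rfl⟩
  obtain ⟨P, τ, ⟨h0, h1⟩, h2, h3⟩ := Nat.sInf_mem hne
  change G.space P τ = G.pers z at h3
  have hc : ∀ t ≤ τ, (P t).card ≤ G.pers z := by
    intro t ht
    rw [← h3]
    exact Finset.le_sup (f := fun t => (P t).card) (by simpa [Nat.lt_succ_iff] using ht)
  have key : ∀ t ≤ τ, ReachK (mold G) (G.pers z + 2) (lift G (P t)) := by
    intro t
    induction t with
    | zero =>
      intro _
      rw [h0]
      exact reachK_place (reachK_empty _ _) (moldSrc G)
        (fun u hu => (mold_edge_src G u hu).elim) (by simp)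
    | succ t ih =>
      intro ht
      exact lift_step (fun v hv => hG v (Relation.TransGen.single hv)) (h1 t ht)
        (hc t (by omega)) (hc _ ht) (ih (by omega))
  have r := reachK_remove (key τ le_rfl) (moldSrc G) (fun u hu => (mold_edge_src G u hu).elim)
  apply pers_le_of_reachK
  convert r using 1
  rw [h2]
  ext u
  rcases mold_cases G u with rfl | ⟨w, rfl⟩ | ⟨w, rfl⟩
  · simp [moldSrc_ne_out]
  · simp [mem_lift, moldOut_ne_in, moldIn_ne_out, moldIn_ne_src]
  · simp [out_mem_lift, moldOut_inj, moldOut_ne_src]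

/-- The projection of a configuration of `mold G` to `G`. -/
def proj (G : Dgraph) (P : Finset (mold G).V) : Finset G.V :=
  Finset.univ.filter fun v => moldOut G v ∈ P ∨ moldIn G v ∈ P

theorem mem_proj (G : Dgraph) (P : Finset (mold G).V) (v : G.V) :
    v ∈ proj G P ↔ moldOut G v ∈ P ∨ moldIn G v ∈ P := by
  simp [proj]

theorem card_proj {G : Dgraph} {P : Finset (mold G).V} {v : G.V} (hs : moldSrc G ∈ P)
    (hi : moldIn G v ∈ P) (ho : moldOut G v ∈ P) : (proj G P).card + 2 ≤ P.card := by
  let f : G.V → (mold G).V := fun w => if moldOut G w ∈ P then moldOut G w else moldIn G w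
  have hf : Function.Injective f := by
    intro a b hab
    simp only [f] at hab
    split_ifs at hab
    · exact (moldOut_inj G).1 hab
    · exact (moldOut_ne_in G hab).elim
    · exact (moldOut_ne_in G hab.symm).elim
    · exact (moldIn_inj G).1 hab
  have h1 : moldIn G v ∉ (proj G P).image f := by
    simp only [Finset.mem_image, f, not_exists, not_and]
    intro w _ h
    split_ifs at h with hw
    · exact moldOut_ne_in G h
    · rw [moldIn_inj] at h
      exact hw (h ▸ ho)
  have h2 : moldSrc G ∉ insert (moldIn G v) ((proj G P).image f) := by
    simp only [Finset.mem_insert, Finset.mem_image, f, not_or, not_exists, not_and]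
    refine ⟨(moldIn_ne_src G).symm, fun w _ h => ?_⟩
    split_ifs at h
    · exact moldOut_ne_src G h
    · exact moldIn_ne_src G h
  have h3 : insert (moldSrc G) (insert (moldIn G v) ((proj G P).image f)) ⊆ P := by
    intro u hu
    simp only [Finset.mem_insert, Finset.mem_image] at hu
    rcases hu with rfl | rfl | ⟨w, hw, rfl⟩
    · exact hs
    · exact hi
    · rw [mem_proj] at hw
      simp only [f]
      split_ifs with h
      · exact h
      · tauto
  have := Finset.card_le_card h3
  rw [Finset.card_insert_of_notMem h2, Finset.card_insert_of_notMem h1,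
    Finset.card_image_of_injective _ hf] at this
  exact this

/-- Moving between configurations that differ only on vertices whose predecessors lie in both. -/
theorem reachK_move {G : Dgraph} {k : ℕ} {X Y : Finset G.V} (h : ReachK G k X)
    (hY : Y.card ≤ k)
    (hd : ∀ v, ¬ (v ∈ X ↔ v ∈ Y) → ∀ u, G.edge u v → u ∈ X ∧ u ∈ Y) : ReachK G k Y := by
  have r1 : ReachK G k (X ∩ Y) := by
    have : ∀ S : Finset G.V, S ⊆ X \ Y → ReachK G k (X \ S) := by
      intro S
      induction S using Finset.induction_on with
      | empty => intro _; simpa using h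
      | insert v S hv ih =>
        intro hS
        have h1 := ih ((Finset.subset_insert _ _).trans hS)
        have hvm := Finset.mem_sdiff.1 (hS (Finset.mem_insert_self v S))
        have := reachK_remove h1 v (by
          intro u hu
          have := hd v (by tauto) u hu
          refine Finset.mem_sdiff.2 ⟨this.1, fun hu' => ?_⟩
          exact (Finset.mem_sdiff.1 (hS (Finset.mem_insert_of_mem hu'))).2 this.2)
        convert this using 1
        ext a; simp; tauto
    have := this _ (Finset.Subset.refl _)
    convert this using 1
    ext a; simp
  have : ∀ S : Finset G.V, S ⊆ Y \ X → ReachK G k ((X ∩ Y) ∪ S) := by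
    intro S
    induction S using Finset.induction_on with
    | empty => intro _; simpa using r1
    | insert v S hv ih =>
      intro hS
      have h1 := ih ((Finset.subset_insert _ _).trans hS)
      have hvm := Finset.mem_sdiff.1 (hS (Finset.mem_insert_self v S))
      rw [Finset.union_insert]
      refine reachK_place h1 v ?_ ((Finset.card_le_card ?_).trans hY)
      · intro u hu
        have := hd v (by tauto) u hu
        simp [this]
      · rw [← Finset.union_insert]
        exact Finset.union_subset Finset.inter_subset_right (hS.trans Finset.sdiff_subset)
  have := this _ (Finset.Subset.refl _)
  convert this using 1
  ext a; simp; tauto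

/-- The invariant for the lower bound. -/
def MoldInv (G : Dgraph) (k : ℕ) (P : Finset (mold G).V) : Prop :=
  ∃ X, ReachK G k X ∧ (∀ v, moldOut G v ∈ P → v ∈ X) ∧
    ∀ v, ¬ (v ∈ X ↔ v ∈ proj G P) → ∀ u, G.edge u v → moldOut G u ∈ P

/-- A change at `s` or at an in-vertex keeps the invariant. -/
theorem inv_easy {G : Dgraph} {k : ℕ} {P P' : Finset (mold G).V} (h : MoldInv G k P)
    (hout : ∀ v, moldOut G v ∈ P' ↔ moldOut G v ∈ P)
    (hin : ∀ v, ¬ (moldIn G v ∈ P' ↔ moldIn G v ∈ P) → ∀ u, G.edge u v → moldOut G u ∈ P) :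
    MoldInv G k P' := by
  obtain ⟨X, hX, h1, h2⟩ := h
  refine ⟨X, hX, fun v hv => h1 v ((hout v).1 hv), fun v hv u hu => (hout u).2 ?_⟩
  by_cases hc : moldIn G v ∈ P' ↔ moldIn G v ∈ P
  · refine h2 v ?_ u hu
    rwa [mem_proj, ← hout v, ← hc, ← mem_proj]
  · exact hin v hc u hu

/-- A change at an out-vertex keeps the invariant, under the space bound. -/
theorem inv_out {G : Dgraph} {k : ℕ} {P P' : Finset (mold G).V} (h : MoldInv G k P)
    (hpr : proj G P' = proj G P) (hc : (proj G P).card ≤ k) : MoldInv G k P' := by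
  obtain ⟨X, hX, h1, h2⟩ := h
  refine ⟨proj G P', ?_, fun v hv => (mem_proj G P' v).2 (Or.inl hv), fun v hv => (hv Iff.rfl).elim⟩
  rw [hpr]
  refine reachK_move hX hc fun v hv u hu => ?_
  have := h2 v hv u hu
  exact ⟨h1 u this, (mem_proj G P u).2 (Or.inl this)⟩

theorem inv_step {G : Dgraph} {k : ℕ} {P P' : Finset (mold G).V} (h : MoldInv G k P)
    (hs : (mold G).RevStep P P') (hP : moldSrc G ∈ P → P.card ≤ k + 2)
    (hP' : moldSrc G ∈ P' → P'.card ≤ k + 2) : MoldInv G k P' := by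
  rcases hs with ⟨x, hx, hp, rfl⟩ | ⟨x, hx, hp, rfl⟩
  · rcases mold_cases G x with rfl | ⟨v, rfl⟩ | ⟨v, rfl⟩
    · refine inv_easy h (fun v => by simp [moldOut_ne_src]) (fun v hv => ?_)
      simp [moldIn_ne_src] at hv
    · refine inv_easy h (fun w => by simp [moldOut_ne_in]) (fun w hw u hu => ?_)
      have : w = v := by
        by_contra hne
        simp [moldIn_inj, hne] at hw
      subst this
      exact hp _ ((mold_edge_in G _ w).2 ⟨u, rfl, hu⟩)
    · have hsrc := hp _ ((mold_edge_out G _ v).2 (Or.inl rfl))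
      have hi := hp _ ((mold_edge_out G _ v).2 (Or.inr rfl))
      have e : proj G (insert (moldOut G v) P) = proj G P := by
        ext w
        simp only [mem_proj, Finset.mem_insert, moldOut_inj, moldIn_ne_out, false_or]
        constructor
        · rintro ((rfl | h) | h) <;> tauto
        · tauto
      refine inv_out h e ?_
      have h1 := card_proj (G := G) (P := insert (moldOut G v) P) (v := v)
        (Finset.mem_insert_of_mem hsrc) (Finset.mem_insert_of_mem hi)
        (Finset.mem_insert_self _ _)
      have h2 := hP' (Finset.mem_insert_of_mem hsrc)
      rw [e] at h1
      omega
  · rcases mold_cases G x with rfl | ⟨v, rfl⟩ | ⟨v, rfl⟩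
    · refine inv_easy h (fun v => by simp [moldOut_ne_src]) (fun v hv => ?_)
      simp [moldIn_ne_src] at hv
    · refine inv_easy h (fun w => by simp [moldOut_ne_in]) (fun w hw u hu => ?_)
      have : w = v := by
        by_contra hne
        simp [moldIn_inj, hne] at hw
      subst this
      exact hp _ ((mold_edge_in G _ w).2 ⟨u, rfl, hu⟩)
    · have hsrc := hp _ ((mold_edge_out G _ v).2 (Or.inl rfl))
      have hi := hp _ ((mold_edge_out G _ v).2 (Or.inr rfl))
      have e : proj G (P.erase (moldOut G v)) = proj G P := by
        ext w
        simp only [mem_proj, Finset.mem_erase, ne_eq, moldOut_inj, moldIn_ne_out,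
          not_false_eq_true, true_and]
        constructor
        · tauto
        · by_cases hw : w = v
          · subst hw; tauto
          · tauto
      refine inv_out h e ?_
      have h1 := card_proj hsrc hi hx
      have h2 := hP hsrc
      omega

theorem molding_lower (G : Dgraph) (z : G.V) (P : ℕ → Finset (mold G).V) (τ : ℕ)
    (hP : (mold G).IsRevPebbling P τ) (hz : moldOut G z ∈ P τ) :
    ∃ b ≤ τ, G.visit z + 2 ≤ (P b).card ∧ moldSrc G ∈ P b := by
  by_contra hcon
  push Not at hcon
  have hb : ∀ b ≤ τ, moldSrc G ∈ P b → (P b).card ≤ (G.visit z - 1) + 2 := by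
    intro b hbt hs
    by_contra h
    exact hcon b hbt (by omega) hs
  have key : ∀ t ≤ τ, MoldInv G (G.visit z - 1) (P t) := by
    intro t
    induction t with
    | zero =>
      intro _
      rw [hP.1]
      exact ⟨∅, reachK_empty _ _, by simp, by simp [mem_proj]⟩
    | succ t ih =>
      intro ht
      exact inv_step (ih (by omega)) (hP.2 t ht) (hb t (by omega)) (hb _ ht)
  obtain ⟨X, hX, h1, _⟩ := key τ le_rfl
  have hzX := h1 z hz
  have h2 := visit_le_of_reachK hX hzX
  have h3 := hX.card_le
  have h4 := Finset.card_pos.2 ⟨z, hzX⟩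
  omega

/-- Molding (Lemma `lem:Molding`): the persistent price of `mold G` is at most
`Pers(G) + 2`, and every reversible pebbling of `mold G` that reaches the sink passes
through a configuration of at least `Visit(G) + 2` pebbles, one of which is on the
special source `s`. -/
theorem molding (G : Dgraph) (hG : G.Acyclic) (z : G.V) (hz : G.UniqueSink z) :
    (mold G).pers (moldOut G z) ≤ G.pers z + 2 ∧
    ∀ (P : ℕ → Finset (mold G).V) (τ : ℕ),
      (mold G).IsRevPebbling P τ → moldOut G z ∈ P τ →
      ∃ b ≤ τ, G.visit z + 2 ≤ (P b).card ∧ moldSrc G ∈ P b := by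
  exact ⟨molding_upper G hG z, fun P τ hP h => molding_lower G z P τ hP h⟩
end

section
/- Let G be a DAG, let v be a vertex of G, let R₂ be a set of vertices of G with v ∈ R₂, and let s₂ ∈ R₂ be a vertex with s₂ ≠ v none of whose immediate predecessors belongs to R₂; set R₁ := R₂ ∖ {s₂}. Then Pers_{R₁}(v) ≤ Pers_{R₂}(v) ≤ Pers_{R₁}(v) + 1, Visit_{R₁}(v) ≤ Visit_{R₂}(v) ≤ Visit_{R₁}(v) + 1, and Surround_{R₁}(v) ≤ Surround_{R₂}(v) ≤ Surround_{R₁}(v) + 1. -/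
namespace Dgraph

/-- `Q` is reachable by an unconditional pebbling of `R`-space at most `k`. -/
def ReachIn (G : Dgraph) (R : Set G.V) (k : ℕ) (Q : Finset G.V) : Prop :=
  ∃ P τ, G.IsRevPebbling P τ ∧ P τ = Q ∧ G.spaceIn R P τ ≤ k

theorem ReachIn.empty (G : Dgraph) (R : Set G.V) (k : ℕ) : G.ReachIn R k ∅ := by
  refine ⟨fun _ => ∅, 0, ⟨rfl, by simp⟩, rfl, ?_⟩
  simp [spaceIn]

theorem ReachIn.step {G : Dgraph} {R : Set G.V} {k : ℕ} {A B : Finset G.V}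
    (h : G.ReachIn R k A) (hs : G.RevStep A B) (hB : ((B : Set G.V) ∩ R).ncard ≤ k) :
    G.ReachIn R k B := by
  obtain ⟨P, τ, ⟨h0, h1⟩, rfl, h3⟩ := h
  refine ⟨fun t => if t ≤ τ then P t else B, τ + 1, ⟨by simpa using h0, ?_⟩, by simp, ?_⟩
  · intro t ht
    rcases Nat.lt_or_ge t τ with h | h
    · have h' : t ≤ τ := h.le
      have h'' : t + 1 ≤ τ := h
      simpa [h', h''] using h1 t h
    · have : t = τ := by omega
      subst this
      simpa using hs
  · unfold spaceIn at *
    rw [Finset.sup_le_iff] at *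
    intro t ht
    by_cases h : t ≤ τ
    · simpa [h] using h3 t (by simp; omega)
    · simpa [h] using hB

theorem ncard_bound (G : Dgraph) (R₂ : Set G.V) (s : G.V) (P Q : Finset G.V)
    (h : ∀ x ∈ R₂ \ {s}, x ∈ Q ↔ x ∈ P) :
    ((Q : Set G.V) ∩ R₂).ncard ≤ ((P : Set G.V) ∩ (R₂ \ {s})).ncard + 1 := by
  have hsub : ((Q : Set G.V) ∩ R₂) ⊆ insert s ((P : Set G.V) ∩ (R₂ \ {s})) := by
    rintro x ⟨hx, hR⟩
    by_cases hxs : x = s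
    · exact Or.inl hxs
    · exact Or.inr ⟨(h x ⟨hR, hxs⟩).1 hx, hR, hxs⟩
  exact (Set.ncard_le_ncard hsub (Set.toFinite _)).trans (Set.ncard_insert_le _ _)

/-- Keep every pebble outside the region. -/
theorem monotone_reach (G : Dgraph) (R₂ : Set G.V) (s : G.V)
    (hsrc : ∀ u : G.V, G.edge u s → u ∉ R₂) (P : ℕ → Finset G.V) (τ : ℕ)
    (hP : G.IsRevPebbling P τ) :
    ∀ t ≤ τ, ∃ Q, G.ReachIn R₂ (G.spaceIn (R₂ \ {s}) P τ + 1) Q ∧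
      (∀ x ∈ R₂ \ {s}, x ∈ Q ↔ x ∈ P t) ∧ P t ⊆ Q ∧
      (s ∈ Q → ∀ u, G.edge u s → u ∈ Q) := by
  have hsp : ∀ t ≤ τ, ((P t : Set G.V) ∩ (R₂ \ {s})).ncard ≤ G.spaceIn (R₂ \ {s}) P τ := by
    intro t ht
    exact Finset.le_sup (f := fun t => ((P t : Set G.V) ∩ (R₂ \ {s})).ncard)
      (by simp; omega)
  intro t
  induction t with
  | zero =>
    intro _
    refine ⟨∅, ReachIn.empty _ _ _, ?_, ?_, ?_⟩ <;> simp [hP.1]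
  | succ t ih =>
    intro ht
    obtain ⟨Q, hQ, hag, hsub, hinv⟩ := ih (by omega)
    have hb := hsp (t + 1) ht
    rcases hP.2 t (by omega) with ⟨x, hx, hpred, he⟩ | ⟨x, hx, hpred, he⟩
    · by_cases hxQ : x ∈ Q
      · refine ⟨Q, hQ, ?_, ?_, hinv⟩
        · intro y hy
          have := hag y hy
          rw [he]
          grind
        · rw [he]
          grind
      · have hag' : ∀ y ∈ R₂ \ {s}, y ∈ insert x Q ↔ y ∈ P (t + 1) := by
          intro y hy
          have := hag y hy
          rw [he]
          grind
        refine ⟨insert x Q, hQ.step (Or.inl ⟨x, hxQ, fun u hu => hsub (hpred u hu), rfl⟩) ?_,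
          hag', ?_, ?_⟩
        · exact (ncard_bound G R₂ s _ _ hag').trans (by omega)
        · rw [he]
          exact Finset.insert_subset_insert _ hsub
        · intro hs u hu
          rcases Finset.mem_insert.1 hs with h | h
          · subst h
            exact Finset.mem_insert_of_mem (hsub (hpred u hu))
          · exact Finset.mem_insert_of_mem (hinv h u hu)
    · by_cases hxR : x ∈ R₂ \ {s}
      · have hag' : ∀ y ∈ R₂ \ {s}, y ∈ Q.erase x ↔ y ∈ P (t + 1) := by
          intro y hy
          have := hag y hy
          rw [he]
          grind
        refine ⟨Q.erase x, hQ.step (Or.inr ⟨x, hsub hx, fun u hu => hsub (hpred u hu), rfl⟩) ?_,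
          hag', ?_, ?_⟩
        · exact (ncard_bound G R₂ s _ _ hag').trans (by omega)
        · rw [he]
          exact Finset.erase_subset_erase _ hsub
        · intro hs u hu
          refine Finset.mem_erase.2 ⟨?_, hinv (Finset.mem_of_mem_erase hs) u hu⟩
          rintro rfl
          exact hsrc _ hu hxR.1
      · refine ⟨Q, hQ, ?_, ?_, hinv⟩
        · intro y hy
          have := hag y hy
          have hyx : y ≠ x := by
            rintro rfl
            exact hxR hy
          rw [he]
          grind
        · rw [he]
          exact (Finset.erase_subset _ _).trans hsub

theorem spaceIn_mono (G : Dgraph) {R R' : Set G.V} (h : R ⊆ R') (P : ℕ → Finset G.V) (τ : ℕ) :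
    G.spaceIn R P τ ≤ G.spaceIn R' P τ :=
  Finset.sup_mono_fun fun _ _ =>
    Set.ncard_le_ncard (Set.inter_subset_inter_right _ h) (Set.toFinite _)

theorem sInf_compare (S₁ S₂ : Set ℕ) (h12 : ∀ a ∈ S₁, ∃ b ∈ S₂, b ≤ a + 1)
    (h21 : ∀ b ∈ S₂, ∃ a ∈ S₁, a ≤ b) : sInf S₁ ≤ sInf S₂ ∧ sInf S₂ ≤ sInf S₁ + 1 := by
  rcases S₁.eq_empty_or_nonempty with h1 | h1
  · have h2 : S₂ = ∅ := by
      by_contra h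
      obtain ⟨b, hb⟩ := Set.nonempty_iff_ne_empty.2 h
      obtain ⟨a, ha, _⟩ := h21 b hb
      simp [h1] at ha
    simp [h1, h2]
  · obtain ⟨b, hb, hb'⟩ := h12 _ (Nat.sInf_mem h1)
    obtain ⟨a, ha, ha'⟩ := h21 _ (Nat.sInf_mem ⟨b, hb⟩)
    exact ⟨(Nat.sInf_le ha).trans ha', (Nat.sInf_le hb).trans hb'⟩

end Dgraph

/-- Source difference (Lemma `lem:SourceDifference`): removing a source vertex from a
region changes each restricted price by at most one. -/
theorem source_difference (G : Dgraph) (hG : G.Acyclic) (v : G.V)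
    (R₂ : Set G.V) (hv : v ∈ R₂) (s₂ : G.V) (hs₂ : s₂ ∈ R₂) (hne : s₂ ≠ v)
    (hsrc : ∀ u : G.V, G.edge u s₂ → u ∉ R₂) :
    (G.persIn (R₂ \ {s₂}) v ≤ G.persIn R₂ v ∧
      G.persIn R₂ v ≤ G.persIn (R₂ \ {s₂}) v + 1) ∧
    (G.visitIn (R₂ \ {s₂}) v ≤ G.visitIn R₂ v ∧
      G.visitIn R₂ v ≤ G.visitIn (R₂ \ {s₂}) v + 1) ∧
    (G.surroundIn (R₂ \ {s₂}) v ≤ G.surroundIn R₂ v ∧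
      G.surroundIn R₂ v ≤ G.surroundIn (R₂ \ {s₂}) v + 1) := by
  have hR : R₂ \ {s₂} ⊆ R₂ := Set.diff_subset
  refine ⟨Dgraph.sInf_compare _ _ ?_ ?_, Dgraph.sInf_compare _ _ ?_ ?_,
    Dgraph.sInf_compare _ _ ?_ ?_⟩
  · rintro a ⟨P, τ, hP, hf, rfl⟩
    obtain ⟨Q, hQ, hag, hsub, hinv⟩ := G.monotone_reach R₂ s₂ hsrc P τ hP τ le_rfl
    have hQ' : G.ReachIn R₂ (G.spaceIn (R₂ \ {s₂}) P τ + 1) (Q.erase s₂) := by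
      by_cases hs : s₂ ∈ Q
      · refine hQ.step (Or.inr ⟨s₂, hs, hinv hs, rfl⟩) ?_
        refine (G.ncard_bound R₂ s₂ (P τ) _ ?_).trans ?_
        · intro x hx
          rw [← hag x hx, Finset.mem_erase]
          exact ⟨fun h => h.2, fun h => ⟨hx.2, h⟩⟩
        · exact Nat.succ_le_succ (Finset.le_sup
            (f := fun t => ((P t : Set G.V) ∩ (R₂ \ {s₂})).ncard) (by simp))
      · rwa [Finset.erase_eq_of_notMem hs]
    obtain ⟨P', τ', h1, h2, h3⟩ := hQ'
    refine ⟨_, ⟨P', τ', h1, ?_, rfl⟩, h3⟩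
    rw [h2, ← hf]
    ext x
    simp only [Finset.coe_erase, Set.mem_inter_iff, Set.mem_diff, Finset.mem_coe,
      Set.mem_singleton_iff]
    constructor
    · rintro ⟨⟨hx, hxs⟩, hxR⟩
      exact ⟨(hag x ⟨hxR, hxs⟩).1 hx, hxR, hxs⟩
    · rintro ⟨hx, hxR, hxs⟩
      exact ⟨⟨hsub hx, hxs⟩, hxR⟩
  · rintro b ⟨P, τ, hP, hf, rfl⟩
    refine ⟨_, ⟨P, τ, hP, ?_, rfl⟩, G.spaceIn_mono hR P τ⟩
    ext x
    have hx : x ∈ (P τ : Set G.V) ∩ R₂ ↔ x ∈ ({v} : Set G.V) := by rw [hf]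
    simp only [Set.mem_inter_iff, Set.mem_diff, Set.mem_singleton_iff] at hx ⊢
    grind
  · rintro a ⟨P, τ, hP, hf, rfl⟩
    obtain ⟨Q, ⟨P', τ', h1, h2, h3⟩, hag, hsub, hinv⟩ :=
      G.monotone_reach R₂ s₂ hsrc P τ hP τ le_rfl
    exact ⟨_, ⟨P', τ', h1, h2 ▸ hsub hf, rfl⟩, h3⟩
  · rintro b ⟨P, τ, hP, hf, rfl⟩
    exact ⟨_, ⟨P, τ, hP, hf, rfl⟩, G.spaceIn_mono hR P τ⟩
  · rintro a ⟨P, τ, hP, hf, rfl⟩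
    obtain ⟨Q, ⟨P', τ', h1, h2, h3⟩, hag, hsub, hinv⟩ :=
      G.monotone_reach R₂ s₂ hsrc P τ hP τ le_rfl
    exact ⟨_, ⟨P', τ', h1, fun u hu => h2 ▸ hsub (hf u hu), rfl⟩, h3⟩
  · rintro b ⟨P, τ, hP, hf, rfl⟩
    exact ⟨_, ⟨P, τ, hP, hf, rfl⟩, G.spaceIn_mono hR P τ⟩
end

section
/- Let B be a blocking set of the pyramid of height h, let v be a vertex at level k such that there exists a directed path from v to the sink whose intersection with B is contained in {v}, and let U be the set of all vertices from which there is a directed path to v (including v itself). Then |B ∖ U| ≥ h − k. -/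
/-- `q` is a `B`-avoiding path starting at `w` and ending in the sink. -/
def FreePath (h : ℕ) (B : Set (pyramid h).V) (w : (pyramid h).V)
    (q : List (pyramid h).V) : Prop :=
  List.IsChain (pyramid h).edge (w :: q) ∧
    (w :: q).getLast (by simp) = pyramidSink h ∧ ∀ x ∈ w :: q, x ∉ B

theorem pyramid_sink_isSink (h : ℕ) : (pyramid h).IsSink (pyramidSink h) := by
  rintro u ⟨h1, -⟩
  have h2 := u.1.1.2
  simp only [pyramidSink, Fin.val_last] at h1
  omega

theorem not_free_source (h : ℕ) (B : Set (pyramid h).V) (hB : (pyramid h).Blocks B)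
    (w : (pyramid h).V) (q : List (pyramid h).V) (hw : (w.1.1 : ℕ) = 0)
    (hf : FreePath h B w q) : False := by
  obtain ⟨h1, h2, h3⟩ := hf
  obtain ⟨x, hx, hxB⟩ := hB (w :: q) (by simp) h1
    (by rintro u ⟨hu, -⟩; simp only [List.head_cons] at hu; omega)
    (by rw [h2]; exact pyramid_sink_isSink h)
  exact h3 x hx hxB

theorem FreePath.cons {h : ℕ} {B : Set (pyramid h).V} {w w' : (pyramid h).V}
    {q : List (pyramid h).V} (hf : FreePath h B w q) (he : (pyramid h).edge w' w)
    (hw : w' ∉ B) : FreePath h B w' (w :: q) := by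
  obtain ⟨h1, h2, h3⟩ := hf
  refine ⟨List.IsChain.cons_cons he h1, ?_, ?_⟩
  · rw [List.getLast_cons (by simp)]; exact h2
  · intro x hx
    rcases List.mem_cons.1 hx with rfl | hx
    · exact hw
    · exact h3 x hx

/-- The line to `w` along which the difference of the coordinates is constant meets `B`. -/
theorem line_diff (h : ℕ) (B : Set (pyramid h).V) (hB : (pyramid h).Blocks B) (n : ℕ) :
    ∀ (w : (pyramid h).V) (q : List (pyramid h).V), (w.1.1 : ℕ) = n → FreePath h B w q →
      ∃ b ∈ B, Relation.ReflTransGen (pyramid h).edge b w ∧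
        (b.1.2 : ℕ) + (w.1.1 : ℕ) = (w.1.2 : ℕ) + (b.1.1 : ℕ) := by
  induction n with
  | zero => intro w q hw hf; exact (not_free_source h B hB w q hw hf).elim
  | succ n ih =>
    intro w q hw hf
    have hle := w.2
    have h2 := w.1.2.2
    obtain ⟨w', hw1, hw2⟩ : ∃ w' : (pyramid h).V, (w'.1.1 : ℕ) = n ∧
        (w'.1.2 : ℕ) + 1 = (w.1.2 : ℕ) :=
      ⟨⟨(⟨n, by omega⟩, ⟨(w.1.2 : ℕ) - 1, by omega⟩), by simp only; omega⟩, rfl,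
        by simp only; omega⟩
    have he : (pyramid h).edge w' w := ⟨by omega, Or.inr (by omega)⟩
    by_cases hb : w' ∈ B
    · exact ⟨w', hb, .single he, by omega⟩
    · obtain ⟨b, hbB, hr, hd⟩ := ih w' _ hw1 (hf.cons he hb)
      exact ⟨b, hbB, hr.tail he, by omega⟩

/-- The line to `w` along which the second coordinate is constant meets `B`. -/
theorem line_snd (h : ℕ) (B : Set (pyramid h).V) (hB : (pyramid h).Blocks B) (n : ℕ) :
    ∀ (w : (pyramid h).V) (q : List (pyramid h).V), (w.1.1 : ℕ) = n → FreePath h B w q →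
      ∃ b ∈ B, Relation.ReflTransGen (pyramid h).edge b w ∧ (b.1.2 : ℕ) = (w.1.2 : ℕ) := by
  induction n with
  | zero => intro w q hw hf; exact (not_free_source h B hB w q hw hf).elim
  | succ n ih =>
    intro w q hw hf
    have hle := w.2
    have h2 := w.1.2.2
    obtain ⟨w', hw1, hw2⟩ : ∃ w' : (pyramid h).V, (w'.1.1 : ℕ) = n ∧
        (w'.1.2 : ℕ) = (w.1.2 : ℕ) :=
      ⟨⟨(⟨n, by omega⟩, w.1.2), by simp only; omega⟩, rfl, rfl⟩
    have he : (pyramid h).edge w' w := ⟨by omega, Or.inl (by omega)⟩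
    by_cases hb : w' ∈ B
    · exact ⟨w', hb, .single he, by omega⟩
    · obtain ⟨b, hbB, hr, hd⟩ := ih w' _ hw1 (hf.cons he hb)
      exact ⟨b, hbB, hr.tail he, by omega⟩

theorem reach_bounds (h : ℕ) (u v : (pyramid h).V)
    (hr : Relation.ReflTransGen (pyramid h).edge u v) :
    (u.1.1 : ℕ) ≤ v.1.1 ∧ (u.1.2 : ℕ) ≤ v.1.2 ∧
      (v.1.2 : ℕ) + u.1.1 ≤ (u.1.2 : ℕ) + v.1.1 := by
  induction hr with
  | refl => exact ⟨le_rfl, le_rfl, le_rfl⟩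
  | tail _ he ih =>
    obtain ⟨h1, h2⟩ := he
    omega

theorem pyramid_blocking_aux (h : ℕ) (B : Set (pyramid h).V) (hB : (pyramid h).Blocks B)
    (q : List (pyramid h).V) : ∀ v : (pyramid h).V,
    List.IsChain (pyramid h).edge (v :: q) →
    (v :: q).getLast (by simp) = pyramidSink h → (∀ x ∈ q, x ∉ B) →
    h - (v.1.1 : ℕ) ≤ (B \ {u | Relation.ReflTransGen (pyramid h).edge u v}).ncard := by
  induction q with
  | nil =>
    intro v _ hl _
    simp only [List.getLast_singleton] at hl
    subst hl
    simp [pyramidSink]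
  | cons w q ih =>
    intro v hc hl hq
    rw [List.isChain_cons_cons] at hc
    obtain ⟨he, hc⟩ := hc
    rw [List.getLast_cons (by simp)] at hl
    have hf : FreePath h B w q := ⟨hc, hl, hq⟩
    have key := ih w hc hl (fun x hx => hq x (List.mem_cons_of_mem _ hx))
    obtain ⟨b, hbB, hbw, hbv⟩ : ∃ b ∈ B, Relation.ReflTransGen (pyramid h).edge b w ∧
        ¬ Relation.ReflTransGen (pyramid h).edge b v := by
      obtain ⟨he1, he2⟩ := he
      rcases he2 with he2 | he2
      · obtain ⟨b, h1, h2, h3⟩ := line_diff h B hB _ w q rfl hf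
        refine ⟨b, h1, h2, fun hr => ?_⟩
        have := reach_bounds h b v hr
        omega
      · obtain ⟨b, h1, h2, h3⟩ := line_snd h B hB _ w q rfl hf
        refine ⟨b, h1, h2, fun hr => ?_⟩
        have := reach_bounds h b v hr
        omega
    have hlt : (B \ {u | Relation.ReflTransGen (pyramid h).edge u w}).ncard <
        (B \ {u | Relation.ReflTransGen (pyramid h).edge u v}).ncard := by
      apply Set.ncard_lt_ncard _ (Set.toFinite _)
      refine ⟨fun x hx => ⟨hx.1, fun hr => hx.2 (hr.tail he)⟩, fun hs => ?_⟩
      exact (hs ⟨hbB, hbv⟩).2 hbw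
    have := he.1
    omega

/-- Blocking sets on pyramids (Proposition `stm:minimalcuts`): if `v` is a vertex at
level `k` joined to the sink by a path meeting the blocking set `B` in at most `{v}`,
and `U` is the set of ancestors of `v` (including `v`), then `|B \ U| ≥ h - k`. -/
theorem pyramid_blocking (h k : ℕ) (B : Set (pyramid h).V)
    (hB : (pyramid h).Blocks B) (v : (pyramid h).V) (hk : (v.1.1 : ℕ) = k)
    (p : List (pyramid h).V) (hp : p ≠ []) (hchain : List.Chain' (pyramid h).edge p)
    (hhead : p.head hp = v) (hlast : p.getLast hp = pyramidSink h)
    (hmeet : ∀ x ∈ p, x ∈ B → x = v) :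
    h - k ≤ (B \ {u | Relation.ReflTransGen (pyramid h).edge u v}).ncard := by
  subst hk
  cases p with
  | nil => exact absurd rfl hp
  | cons a q =>
    simp only [List.head_cons] at hhead
    subst hhead
    refine pyramid_blocking_aux h B hB q a hchain hlast (fun x hx hxB => ?_)
    have hxa := hmeet x (List.mem_cons_of_mem _ hx) hxB
    subst hxa
    obtain ⟨s, t, rfl⟩ := List.append_of_mem hx
    have hT : List.IsChain (fun u v : (pyramid h).V => (u.1.1 : ℕ) < v.1.1)
        (x :: (s ++ x :: t)) :=
      List.IsChain.imp (fun u v huv => by have := huv.1; omega) hchain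
    haveI : IsTrans (pyramid h).V (fun u v : (pyramid h).V => (u.1.1 : ℕ) < v.1.1) :=
      ⟨fun _ _ _ => lt_trans⟩
    have := (List.pairwise_cons.1 (List.isChain_iff_pairwise.1 hT)).1 x (by simp)
    exact lt_irrefl _ this
end
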